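/- Let F ∈ F̃^k be a minimal spanning entering forest with k trees, let y ∈ K_F, and let G ∈ R^F_y be a descendant of F obtained at root y. Then G ∈ F̃^{k−1} if and only if both (i) Υ^G_{V(T^F_y)} = λ°_{V(T^F_y)} and (ii) λ°_{V(T^F_y)} − λ^•_{V(T^F_y)} = min_{l ∈ K_F} ( λ°_{V(T^F_l)} − λ^•_{V(T^F_l)} ). -/

import Mathlib

open scoped Classical

namespace BarrierForests

variable {α : Type*} [Fintype α] [DecidableEq α]

/-- Total weight of a set of arcs. -/
def aweight (v : α → α → ℝ) (A : Finset (α × α)) : ℝ := ∑ a ∈ A, v a.1 a.2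

/-- Weight `Υ^A_S` of the arcs of `A` whose tail lies in `S`. -/
def aweightOn (v : α → α → ℝ) (A : Finset (α × α)) (S : Finset α) : ℝ :=
  ∑ a ∈ A.filter (fun a => a.1 ∈ S), v a.1 a.2

/-- The relation "there is an arc from `i` to `j` in `A`". -/
def arcRel (A : Finset (α × α)) : α → α → Prop := fun i j => (i, j) ∈ A

/-- Entering forest: every vertex has out-degree at most one, and there are no
directed cycles. -/
def IsEForest (A : Finset (α × α)) : Prop :=
  (∀ i j j', (i, j) ∈ A → (i, j') ∈ A → j = j') ∧
  ∀ i, ¬ Relation.TransGen (arcRel A) i i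

/-- Roots of a (spanning) entering forest: the vertices with no outgoing arc. -/
noncomputable def rootSet (A : Finset (α × α)) : Finset α :=
  Finset.univ.filter fun i => ∀ j, (i, j) ∉ A

/-- `𝓕^k`: spanning entering forests of the digraph with arc set `E`
having exactly `k` trees (equivalently, `k` roots). -/
def FSet (E : Finset (α × α)) (k : ℕ) : Set (Finset (α × α)) :=
  {A | A ⊆ E ∧ IsEForest A ∧ (rootSet A).card = k}

/-- The infimum (in `EReal`, so `⊤` for the empty family) of the `w`-weights of the
members of `s`. -/
noncomputable def minW {β : Type*} (s : Set β) (w : β → ℝ) : EReal :=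
  sInf ((fun x => (w x : EReal)) '' s)

/-- `φ^k`: minimum weight of a spanning entering forest with `k` trees. -/
noncomputable def phi (v : α → α → ℝ) (E : Finset (α × α)) (k : ℕ) : EReal :=
  minW (FSet E k) (aweight v)

/-- `F ∈ 𝓕̃^k`: minimal spanning entering forest with `k` trees. -/
def IsMinForest (v : α → α → ℝ) (E : Finset (α × α)) (k : ℕ) (F : Finset (α × α)) : Prop :=
  F ∈ FSet E k ∧ (aweight v F : EReal) = phi v E k

/-- Vertex set of the tree `T^F_i` of the entering forest `F` rooted at `i`:
all vertices from which `i` is reachable. -/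
noncomputable def treeVerts (F : Finset (α × α)) (i : α) : Finset α :=
  Finset.univ.filter fun j => Relation.ReflTransGen (arcRel F) j i

/-- Arc set of the tree `T^F_i`. -/
noncomputable def treeArcs (F : Finset (α × α)) (i : α) : Finset (α × α) :=
  F.filter fun a => a.1 ∈ treeVerts F i

/-- Induced subgraph (restriction) of the arc set `A` on the vertex set `S`. -/
def restrictArcs (A : Finset (α × α)) (S : Finset α) : Finset (α × α) :=
  A.filter fun a => a.1 ∈ S ∧ a.2 ∈ S

/-- `T ∈ 𝓣^{•q}_S`: `T` is an entering tree that is a subgraph of the digraph with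
arc set `E`, with vertex set `S` and root `q`. -/
def IsTreeOn (E T : Finset (α × α)) (S : Finset α) (q : α) : Prop :=
  q ∈ S ∧ T ⊆ E ∧ (∀ a ∈ T, a.1 ∈ S ∧ a.2 ∈ S) ∧
  (∀ i ∈ S, i ≠ q → ∃! j, (i, j) ∈ T) ∧
  (∀ j, (q, j) ∉ T) ∧
  ∀ i ∈ S, Relation.ReflTransGen (arcRel T) i q

/-- `λ^{•q}_S`. -/
noncomputable def lamB (v : α → α → ℝ) (E : Finset (α × α)) (S : Finset α) (q : α) : EReal :=
  minW {T | IsTreeOn E T S q} (aweight v)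

/-- `λ^•_S = min_{q ∈ S} λ^{•q}_S`. -/
noncomputable def lamBul (v : α → α → ℝ) (E : Finset (α × α)) (S : Finset α) : EReal :=
  minW {T | ∃ q ∈ S, IsTreeOn E T S q} (aweight v)

/-- `T ∈ 𝓣^{∘q}_S`: `T` has `|S| + 1` vertices, `T|_S` is an entering tree with vertex
set `S` and root `q`, and the single arc of `T` leaving `S` goes from `q` to the root
`r ∉ S` of `T`. -/
def IsCTreeOn (E T : Finset (α × α)) (S : Finset α) (q : α) : Prop :=
  ∃ r, r ∉ S ∧ ∃ T', IsTreeOn E T' S q ∧ (q, r) ∈ E ∧ T = insert (q, r) T'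

/-- `λ^{∘q}_S`. -/
noncomputable def lamC (v : α → α → ℝ) (E : Finset (α × α)) (S : Finset α) (q : α) : EReal :=
  minW {T | IsCTreeOn E T S q} (aweight v)

/-- `λ^∘_S = min_{q ∈ S} λ^{∘q}_S`. -/
noncomputable def lamCirc (v : α → α → ℝ) (E : Finset (α × α)) (S : Finset α) : EReal :=
  minW {T | ∃ q ∈ S, IsCTreeOn E T S q} (aweight v)

/-- `μ^∘_S`: minimum of `Υ^F_S` over the spanning entering forests `F ∈ 𝓕^∘_S`,
i.e. those in which every vertex of `S` has an outgoing arc. -/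
noncomputable def muCirc (v : α → α → ℝ) (E : Finset (α × α)) (S : Finset α) : EReal :=
  minW {A | A ⊆ E ∧ IsEForest A ∧ ∀ i ∈ S, ∃ j, (i, j) ∈ A} fun A => aweightOn v A S

/-- `G ∈ 𝓡^F_y`: `G` is a descendant of `F` at the root `y`, i.e. `y` is a root of
`F`, the roots of `G` are those of `F` except `y`, `G` induces `T^F_q` on the vertex
set of every tree of `F` other than `T^F_y`, and `G` induces a tree on the vertex set
of `T^F_y`. -/
def IsDescendant (E F G : Finset (α × α)) (y : α) : Prop :=
  y ∈ rootSet F ∧ rootSet G = rootSet F \ {y} ∧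
  (∀ q ∈ rootSet G, restrictArcs G (treeVerts F q) = treeArcs F q) ∧
  ∃ a ∈ treeVerts F y, IsTreeOn E (restrictArcs G (treeVerts F y)) (treeVerts F y) a

/-- A potential graph: a connected weighted undirected graph with a loop at every
vertex.  Edges are recorded as a symmetric reflexive set of ordered pairs, with a
symmetric weight function `p`. -/
structure PotGraph (α : Type*) [Fintype α] [DecidableEq α] where
  p : α → α → ℝ
  edges : Finset (α × α)
  symm_mem : ∀ i j, (i, j) ∈ edges → (j, i) ∈ edges
  loop_mem : ∀ i, (i, i) ∈ edges
  symm_w : ∀ i j, p i j = p j i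
  connected : ∀ i j : α, Relation.ReflTransGen (fun a b => (a, b) ∈ edges ∧ a ≠ b) i j

/-- Arc set of the barrier digraph of the potential graph `P`: an arc `(i,j)`, `i ≠ j`,
for each non-loop edge of `P`. -/
def barcs (P : PotGraph α) : Finset (α × α) := P.edges.filter fun a => a.1 ≠ a.2

/-- Arc weights of the barrier digraph: `v i j = p i j - p i i`. -/
def bw (P : PotGraph α) : α → α → ℝ := fun i j => P.p i j - P.p i i

/-- Weight of a set of undirected edges of `P`. -/
noncomputable def uweight (P : PotGraph α) (T : Finset (Sym2 α)) : ℝ :=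
  ∑ e ∈ T, Sym2.lift ⟨P.p, P.symm_w⟩ e

/-- `T ∈ 𝓣_S`: `T` is an undirected tree that is a subgraph of `P` (loops unused)
with vertex set `S`: its edges are non-loop edges of `P` joining vertices of `S`,
it is connected on `S`, and it has `|S| - 1` edges. -/
def IsUTreeOn (P : PotGraph α) (T : Finset (Sym2 α)) (S : Finset α) : Prop :=
  (∀ e ∈ T, ∃ i j, i ≠ j ∧ e = s(i, j) ∧ (i, j) ∈ P.edges ∧ i ∈ S ∧ j ∈ S) ∧
  (∀ i ∈ S, ∀ j ∈ S, Relation.ReflTransGen (fun a b => s(a, b) ∈ T) i j) ∧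
  T.card + 1 = S.card

/-- `ν_S`: minimum weight of an undirected tree on `S` that is a subgraph of `P`. -/
noncomputable def nu (P : PotGraph α) (S : Finset α) : EReal :=
  minW {T | IsUTreeOn P T S} (uweight P)

/-- The underlying undirected edge set of a set of arcs. -/
def undir (A : Finset (α × α)) : Finset (Sym2 α) := A.image fun a => s(a.1, a.2)

/-- `Tq` is the entering tree (with root `q`, vertex set `S`, subgraph of the barrier
digraph of `P`) corresponding to the undirected tree `T`: it is obtained from `T` by
directing all edges toward `q` and replacing the weight of each arc `(i,j)` by
`v i j = p i j - p i i`. -/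
def Corresponds (P : PotGraph α) (Tq : Finset (α × α)) (T : Finset (Sym2 α))
    (S : Finset α) (q : α) : Prop :=
  IsTreeOn (barcs P) Tq S q ∧ undir Tq = T

section helpers

lemma exit_lemma (X A : Finset (α × α)) (S : Finset α) (h : ∀ a ∈ X, a.1 ∈ S → a ∈ A)
    {i r : α} (hir : Relation.ReflTransGen (arcRel X) i r) :
    ∃ j, Relation.ReflTransGen (arcRel A) i j ∧ Relation.ReflTransGen (arcRel X) j r ∧
      (j = r ∨ j ∉ S) ∧ (j = i ∨ ∃ p ∈ S, (p, j) ∈ X) := by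
  induction hir using Relation.ReflTransGen.head_induction_on with
  | refl => exact ⟨r, .refl, .refl, Or.inl rfl, Or.inl rfl⟩
  | head hab hbr ih =>
    rename_i a b
    by_cases ha : a ∈ S
    · obtain ⟨j, h1, h2, h3, h4⟩ := ih
      refine ⟨j, .head (h _ hab ha) h1, h2, h3, Or.inr ?_⟩
      rcases h4 with rfl | h4
      · exact ⟨a, ha, hab⟩
      · exact h4
    · exact ⟨a, .refl, .head hab hbr, Or.inr ha, Or.inl rfl⟩

lemma exit_step (X : Finset (α × α)) (S : Finset α) {i r : α}
    (hir : Relation.ReflTransGen (arcRel X) i r) (hi : i ∈ S) (hr : r ∉ S) :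
    ∃ q t, q ∈ S ∧ t ∉ S ∧ (q, t) ∈ X ∧
      Relation.ReflTransGen (arcRel (restrictArcs X S)) i q := by
  induction hir using Relation.ReflTransGen.head_induction_on with
  | refl => exact absurd hi hr
  | head hab hbr ih =>
    rename_i a b
    by_cases hb : b ∈ S
    · obtain ⟨q, t, h1, h2, h3, h4⟩ := ih hb
      refine ⟨q, t, h1, h2, h3, .head ?_ h4⟩
      simp only [arcRel, restrictArcs, Finset.mem_filter]
      exact ⟨hab, hi, hb⟩
    · exact ⟨a, b, hi, hb, hab, .refl⟩

lemma mem_rootSet {A : Finset (α × α)} {i : α} : i ∈ rootSet A ↔ ∀ j, (i, j) ∉ A := by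
  simp [rootSet]

lemma mem_treeVerts {A : Finset (α × α)} {i j : α} :
    j ∈ treeVerts A i ↔ Relation.ReflTransGen (arcRel A) j i := by
  simp [treeVerts]

lemma root_of_reach {A : Finset (α × α)} {i r : α} (hi : i ∈ rootSet A)
    (h : Relation.ReflTransGen (arcRel A) i r) : i = r := by
  rcases Relation.ReflTransGen.cases_head h with h | ⟨c, hc, -⟩
  · exact h
  · exact absurd hc (mem_rootSet.1 hi c)

lemma forest_of_reach {A : Finset (α × α)}
    (hf : ∀ i j j', (i, j) ∈ A → (i, j') ∈ A → j = j')
    (hr : ∀ i, ∃ r ∈ rootSet A, Relation.ReflTransGen (arcRel A) i r) : IsEForest A := by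
  refine ⟨hf, ?_⟩
  intro i hi
  obtain ⟨r, hr, hir⟩ := hr i
  have key : Relation.TransGen (arcRel A) r r := by
    induction hir using Relation.ReflTransGen.head_induction_on with
    | refl => exact hi
    | head hab hbr ih =>
      rename_i a b
      apply ih
      obtain ⟨c, hac, hca⟩ := Relation.TransGen.head'_iff.1 hi
      have : c = b := hf _ _ _ hac hab
      subst this
      exact Relation.TransGen.tail' hca hab
  obtain ⟨c, hac, -⟩ := Relation.TransGen.head'_iff.1 key
  exact mem_rootSet.1 hr c hac

lemma reach_of_forest {A : Finset (α × α)} (h : IsEForest A) (i : α) :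
    ∃ r ∈ rootSet A, Relation.ReflTransGen (arcRel A) i r := by
  have wf : WellFounded (fun a b => Relation.TransGen (arcRel A) b a) := by
    haveI : IsTrans α (fun a b => Relation.TransGen (arcRel A) b a) :=
      ⟨fun a b c h1 h2 => h2.trans h1⟩
    haveI : Std.Irrefl (fun a b => Relation.TransGen (arcRel A) b a) := ⟨fun a => h.2 a⟩
    exact Finite.wellFounded_of_trans_of_irrefl _
  induction i using wf.induction with
  | _ i ih =>
    by_cases hi : i ∈ rootSet A
    · exact ⟨i, hi, .refl⟩
    · rw [mem_rootSet] at hi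
      push Not at hi
      obtain ⟨j, hj⟩ := hi
      obtain ⟨r, hr, hjr⟩ := ih j (.single hj)
      exact ⟨r, hr, .head hj hjr⟩

/-- `X` on tails in `S`, `Y` elsewhere. -/
noncomputable def mix (X Y : Finset (α × α)) (S : Finset α) : Finset (α × α) :=
  X.filter (fun a => a.1 ∈ S) ∪ Y.filter (fun a => a.1 ∉ S)

lemma mem_mix {X Y : Finset (α × α)} {S : Finset α} {a : α × α} :
    a ∈ mix X Y S ↔ (a ∈ X ∧ a.1 ∈ S) ∨ (a ∈ Y ∧ a.1 ∉ S) := by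
  simp [mix]

lemma mix_func {X Y : Finset (α × α)} {S : Finset α}
    (hX : ∀ i j j', (i, j) ∈ X → (i, j') ∈ X → j = j')
    (hY : ∀ i j j', (i, j) ∈ Y → (i, j') ∈ Y → j = j') :
    ∀ i j j', (i, j) ∈ mix X Y S → (i, j') ∈ mix X Y S → j = j' := by
  intro i j j' h h'
  rw [mem_mix] at h h'
  rcases h with ⟨h1, h2⟩ | ⟨h1, h2⟩ <;> rcases h' with ⟨h3, h4⟩ | ⟨h3, h4⟩
  · exact hX _ _ _ h1 h3
  · exact absurd h2 h4
  · exact absurd h4 h2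
  · exact hY _ _ _ h1 h3

lemma mem_rootSet_mix {X Y : Finset (α × α)} {S : Finset α} {i : α} :
    i ∈ rootSet (mix X Y S) ↔ (i ∈ S ∧ i ∈ rootSet X) ∨ (i ∉ S ∧ i ∈ rootSet Y) := by
  simp only [mem_rootSet, mem_mix]
  by_cases h : i ∈ S <;> simp [h]

lemma aweight_split (v : α → α → ℝ) (A : Finset (α × α)) (S : Finset α) :
    aweight v A = aweightOn v A S + aweightOn v A Sᶜ := by
  unfold aweight aweightOn
  rw [← Finset.sum_filter_add_sum_filter_not A (fun a => a.1 ∈ S)]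
  simp only [Finset.mem_compl]

lemma aweight_mix (v : α → α → ℝ) (X Y : Finset (α × α)) (S : Finset α) :
    aweight v (mix X Y S) = aweightOn v X S + aweightOn v Y Sᶜ := by
  unfold aweight aweightOn mix
  rw [Finset.sum_union]
  · simp only [Finset.mem_compl]
  · rw [Finset.disjoint_left]
    intro a h1 h2
    simp only [Finset.mem_filter] at h1 h2
    exact h2.2 h1.2

lemma aweightOn_sdiff (v : α → α → ℝ) (A : Finset (α × α)) {S D : Finset α} (h : D ⊆ S) :
    aweightOn v A S = aweightOn v A D + aweightOn v A (S \ D) := by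
  unfold aweightOn
  rw [← Finset.sum_filter_add_sum_filter_not (A.filter (fun a => a.1 ∈ S)) (fun a => a.1 ∈ D)]
  congr 1
  · apply Finset.sum_congr _ (fun _ _ => rfl)
    ext a
    simp only [Finset.mem_filter]
    constructor
    · rintro ⟨⟨h1, h2⟩, h3⟩; exact ⟨h1, h3⟩
    · rintro ⟨h1, h3⟩; exact ⟨⟨h1, h h3⟩, h3⟩
  · apply Finset.sum_congr _ (fun _ _ => rfl)
    ext a
    simp only [Finset.mem_filter, Finset.mem_sdiff]
    tauto

lemma aweightOn_of_tails (v : α → α → ℝ) {A : Finset (α × α)} {S : Finset α}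
    (h : ∀ a ∈ A, a.1 ∈ S) : aweightOn v A S = aweight v A := by
  unfold aweightOn aweight
  rw [Finset.filter_true_of_mem h]

lemma tree_back {F : Finset (α × α)} {l p j : α} (hpj : (p, j) ∈ F)
    (hj : j ∈ treeVerts F l) : p ∈ treeVerts F l := by
  rw [mem_treeVerts] at *
  exact .head hpj hj

lemma tree_fwd {F : Finset (α × α)} (hF : ∀ i j j', (i, j) ∈ F → (i, j') ∈ F → j = j')
    {l p j : α} (hl : l ∈ rootSet F) (hpj : (p, j) ∈ F)
    (hp : p ∈ treeVerts F l) : j ∈ treeVerts F l := by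
  rw [mem_treeVerts] at *
  rcases Relation.ReflTransGen.cases_head hp with rfl | ⟨c, hc, hcl⟩
  · exact absurd hpj (mem_rootSet.1 hl j)
  · rwa [hF _ _ _ hpj hc]

lemma tree_self (F : Finset (α × α)) (l : α) : l ∈ treeVerts F l :=
  mem_treeVerts.2 .refl

/-- outside the tree, a graph coinciding with `F` there still leads to the `F`-roots -/
lemma outside_reach {F A : Finset (α × α)} {S : Finset α} (hF : IsEForest F)
    (hS : ∀ p j, (p, j) ∈ F → j ∈ S → p ∈ S)
    (hA : ∀ a ∈ F, a.1 ∉ S → a ∈ A) {i : α} (hi : i ∉ S) :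
    ∃ r ∈ rootSet F, r ∉ S ∧ Relation.ReflTransGen (arcRel A) i r := by
  obtain ⟨r, hr, hir⟩ := reach_of_forest hF i
  obtain ⟨j, h1, h2, h3, h4⟩ := exit_lemma F A Sᶜ
    (fun a ha h => hA a ha (Finset.mem_compl.1 h)) hir
  have hj : j ∉ S := by
    rcases h4 with rfl | ⟨p, hp, hpj⟩
    · exact hi
    · intro hj
      exact Finset.mem_compl.1 hp (hS _ _ hpj hj)
  rcases h3 with rfl | h3
  · exact ⟨j, hr, hj, h1⟩
  · exact absurd (Finset.mem_compl.2 hj) h3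

lemma tree_func {E T : Finset (α × α)} {S : Finset α} {q : α} (h : IsTreeOn E T S q) :
    ∀ i j j', (i, j) ∈ T → (i, j') ∈ T → j = j' := by
  obtain ⟨-, -, h3, h4, h5, -⟩ := h
  intro i j j' hj hj'
  have hiq : i ≠ q := by
    rintro rfl
    exact h5 _ hj
  exact (h4 i (h3 _ hj).1 hiq).unique hj hj'

lemma tree_rootSet {E T : Finset (α × α)} {S : Finset α} {q i : α} (h : IsTreeOn E T S q)
    (hi : i ∈ S) : i ∈ rootSet T ↔ i = q := by
  obtain ⟨-, -, h3, h4, h5, -⟩ := h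
  constructor
  · intro h
    by_contra hne
    obtain ⟨j, hj, -⟩ := h4 i hi hne
    exact mem_rootSet.1 h j hj
  · rintro rfl
    exact mem_rootSet.2 h5

lemma root_in_tree {F : Finset (α × α)} {l i : α} (hi : i ∈ rootSet F) :
    i ∈ treeVerts F l ↔ i = l := by
  constructor
  · intro h; exact root_of_reach hi (mem_treeVerts.1 h)
  · rintro rfl; exact tree_self F i

/-- replacing a tree by another tree on the same vertex set -/
lemma replace_tree {E F T : Finset (α × α)} {k : ℕ} (hF : F ∈ FSet E k) {l q : α}
    (hl : l ∈ rootSet F) (hT : IsTreeOn E T (treeVerts F l) q) :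
    mix T F (treeVerts F l) ∈ FSet E k := by
  obtain ⟨hFE, hFf, hFk⟩ := hF
  have hroots : rootSet (mix T F (treeVerts F l)) = insert q ((rootSet F).erase l) := by
    ext i
    rw [mem_rootSet_mix, Finset.mem_insert, Finset.mem_erase]
    by_cases hi : i ∈ treeVerts F l
    · rw [tree_rootSet hT hi]
      constructor
      · rintro (h | h)
        · exact Or.inl h.2
        · exact absurd hi h.1
      · rintro (h | h)
        · exact Or.inl ⟨hi, h⟩
        · exact absurd ((root_in_tree h.2).1 hi) h.1
    · constructor
      · rintro (h | h)
        · exact absurd h.1 hi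
        · refine Or.inr ⟨?_, h.2⟩
          rintro rfl
          exact hi (tree_self F i)
      · rintro (h | h)
        · subst h; exact absurd hT.1 hi
        · exact Or.inr ⟨hi, h.2⟩
  refine ⟨?_, forest_of_reach (mix_func (tree_func hT) hFf.1) ?_, ?_⟩
  · intro a ha
    rcases mem_mix.1 ha with h | h
    · exact hT.2.1 h.1
    · exact hFE h.1
  · intro i
    by_cases hi : i ∈ treeVerts F l
    · refine ⟨q, by rw [hroots]; simp, ?_⟩
      exact Relation.ReflTransGen.mono (fun a b hab =>
        mem_mix.2 (Or.inl ⟨hab, (hT.2.2.1 _ hab).1⟩)) _ _ (hT.2.2.2.2.2 i hi)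
    · obtain ⟨r, h1, h2, h3⟩ := outside_reach (A := mix T F (treeVerts F l)) hFf
        (fun p j h hj => tree_back h hj) (fun a ha h => mem_mix.2 (Or.inr ⟨ha, h⟩)) hi
      exact ⟨r, mem_rootSet_mix.2 (Or.inr ⟨h2, h1⟩), h3⟩
  · rw [hroots, Finset.card_insert_of_notMem, Finset.card_erase_of_mem hl, hFk]
    · have : 0 < (rootSet F).card := Finset.card_pos.2 ⟨l, hl⟩
      omega
    · intro h
      rw [Finset.mem_erase] at h
      exact h.1 ((root_in_tree h.2).1 hT.1)

/-- replacing a tree by a tree with an exit -/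
lemma replace_ctree {E F T : Finset (α × α)} {k : ℕ} (hF : F ∈ FSet E k) {l q : α}
    (hl : l ∈ rootSet F) (hT : IsCTreeOn E T (treeVerts F l) q) :
    mix T F (treeVerts F l) ∈ FSet E (k - 1) ∧ ∀ a ∈ T, a.1 ∈ treeVerts F l := by
  obtain ⟨hFE, hFf, hFk⟩ := hF
  obtain ⟨r, hr, T', hT', hqr, rfl⟩ := hT
  have htails : ∀ a ∈ insert (q, r) T', a.1 ∈ treeVerts F l := by
    intro a ha
    rcases Finset.mem_insert.1 ha with rfl | ha
    · exact hT'.1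
    · exact (hT'.2.2.1 a ha).1
  have hfun : ∀ i j j', (i, j) ∈ insert (q, r) T' → (i, j') ∈ insert (q, r) T' → j = j' := by
    intro i j j' h h'
    rw [Finset.mem_insert, Prod.mk.injEq] at h h'
    rcases h with ⟨rfl, rfl⟩ | h <;> rcases h' with ⟨h1, h2⟩ | h'
    · exact h2.symm
    · exact absurd h' (hT'.2.2.2.2.1 _)
    · subst h1; exact absurd h (hT'.2.2.2.2.1 _)
    · exact tree_func hT' _ _ _ h h'
  have hroots : rootSet (mix (insert (q, r) T') F (treeVerts F l)) = (rootSet F).erase l := by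
    ext i
    rw [mem_rootSet_mix, Finset.mem_erase]
    by_cases hi : i ∈ treeVerts F l
    · constructor
      · rintro (h | h)
        · exfalso
          by_cases hiq : i = q
          · subst hiq
            exact mem_rootSet.1 h.2 r (Finset.mem_insert_self _ _)
          · obtain ⟨j, hj, -⟩ := hT'.2.2.2.1 i hi hiq
            exact mem_rootSet.1 h.2 j (Finset.mem_insert_of_mem hj)
        · exact absurd hi h.1
      · intro h
        exact absurd ((root_in_tree h.2).1 hi) h.1
    · constructor
      · rintro (h | h)
        · exact absurd h.1 hi
        · refine ⟨?_, h.2⟩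
          rintro rfl
          exact hi (tree_self F i)
      · intro h
        exact Or.inr ⟨hi, h.2⟩
  have hout : ∀ i, i ∉ treeVerts F l →
      ∃ s ∈ rootSet (mix (insert (q, r) T') F (treeVerts F l)),
        Relation.ReflTransGen (arcRel (mix (insert (q, r) T') F (treeVerts F l))) i s := by
    intro i hi
    obtain ⟨r, h1, h2, h3⟩ := outside_reach (A := mix (insert (q, r) T') F (treeVerts F l)) hFf
        (fun p j h hj => tree_back h hj) (fun a ha h => mem_mix.2 (Or.inr ⟨ha, h⟩)) hi
    exact ⟨r, mem_rootSet_mix.2 (Or.inr ⟨h2, h1⟩), h3⟩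
  refine ⟨⟨?_, forest_of_reach (mix_func hfun hFf.1) ?_, ?_⟩, htails⟩
  · intro a ha
    rcases mem_mix.1 ha with h | h
    · rcases Finset.mem_insert.1 h.1 with rfl | h
      · exact hqr
      · exact hT'.2.1 h
    · exact hFE h.1
  · intro i
    by_cases hi : i ∈ treeVerts F l
    · obtain ⟨s, hs, hrs⟩ := hout r hr
      refine ⟨s, hs, ?_⟩
      have h1 : Relation.ReflTransGen
          (arcRel (mix (insert (q, r) T') F (treeVerts F l))) i q :=
        Relation.ReflTransGen.mono (fun a b hab =>
          mem_mix.2 (Or.inl ⟨Finset.mem_insert_of_mem hab, (hT'.2.2.1 _ hab).1⟩)) _ _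
          (hT'.2.2.2.2.2 i hi)
      exact h1.trans (.head (mem_mix.2 (Or.inl ⟨Finset.mem_insert_self _ _, hT'.1⟩)) hrs)
    · exact hout i hi
  · rw [hroots, Finset.card_erase_of_mem hl, hFk]

/-- first swap -/
lemma swap_one {E F H : Finset (α × α)} {k : ℕ} (hk : 1 ≤ k) (hF : F ∈ FSet E k)
    (hH : H ∈ FSet E (k - 1)) {l : α}
    (hl : l ∈ rootSet F) (hno : ∀ i ∈ rootSet H, i ∉ treeVerts F l) :
    mix F H (treeVerts F l) ∈ FSet E k := by
  obtain ⟨hFE, hFf, hFk⟩ := hF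
  obtain ⟨hHE, hHf, hHk⟩ := hH
  have hroots : rootSet (mix F H (treeVerts F l)) = insert l (rootSet H) := by
    ext i
    rw [mem_rootSet_mix, Finset.mem_insert]
    constructor
    · rintro (h | h)
      · exact Or.inl ((root_in_tree h.2).1 h.1)
      · exact Or.inr h.2
    · rintro (h | h)
      · subst h; exact Or.inl ⟨tree_self F i, hl⟩
      · exact Or.inr ⟨hno i h, h⟩
  have hin : ∀ i ∈ treeVerts F l,
      Relation.ReflTransGen (arcRel (mix F H (treeVerts F l))) i l := by
    intro i hi
    obtain ⟨j, h1, h2, h3, -⟩ := exit_lemma F (mix F H (treeVerts F l)) (treeVerts F l)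
      (fun a ha h => mem_mix.2 (Or.inl ⟨ha, h⟩)) (mem_treeVerts.1 hi)
    rcases h3 with rfl | h3
    · exact h1
    · exact absurd (mem_treeVerts.2 h2) h3
  refine ⟨?_, forest_of_reach (mix_func hFf.1 hHf.1) ?_, ?_⟩
  · intro a ha
    rcases mem_mix.1 ha with h | h
    · exact hFE h.1
    · exact hHE h.1
  · intro i
    obtain ⟨r, hr, hir⟩ := reach_of_forest hHf i
    obtain ⟨j, h1, h2, h3, -⟩ := exit_lemma H (mix F H (treeVerts F l)) (treeVerts F l)ᶜ
      (fun a ha h => mem_mix.2 (Or.inr ⟨ha, Finset.mem_compl.1 h⟩)) hir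
    rcases h3 with rfl | h3
    · exact ⟨j, by rw [hroots]; exact Finset.mem_insert_of_mem hr, h1⟩
    · refine ⟨l, by rw [hroots]; exact Finset.mem_insert_self _ _, h1.trans (hin j ?_)⟩
      simpa using h3
  · rw [hroots, Finset.card_insert_of_notMem, hHk]
    · omega
    · intro h
      exact hno l h (tree_self F l)

/-- second swap -/
lemma swap_two {E F H : Finset (α × α)} {k m : ℕ} (hF : F ∈ FSet E k)
    (hH : H ∈ FSet E m) {l : α}
    (hno : ∀ i ∈ rootSet H, i ∉ treeVerts F l) (D : Finset α)
    (hlD : l ∈ D) (hD : ∀ p j, p ∈ treeVerts F l → p ∉ D → (p, j) ∈ H → j ∉ D) :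
    mix H F (treeVerts F l \ D) ∈ FSet E k := by
  obtain ⟨hFE, hFf, hFk⟩ := hF
  obtain ⟨hHE, hHf, hHk⟩ := hH
  set S := treeVerts F l with hS
  have hroots : rootSet (mix H F (S \ D)) = rootSet F := by
    ext i
    rw [mem_rootSet_mix, Finset.mem_sdiff]
    constructor
    · rintro (h | h)
      · exact absurd h.1.1 (hno i h.2)
      · exact h.2
    · intro h
      refine Or.inr ⟨?_, h⟩
      rintro ⟨h1, h2⟩
      rw [(root_in_tree h).1 h1] at h2
      exact h2 hlD
  have hout : ∀ i, i ∉ S →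
      ∃ s ∈ rootSet (mix H F (S \ D)),
        Relation.ReflTransGen (arcRel (mix H F (S \ D))) i s := by
    intro i hi
    obtain ⟨r, h1, h2, h3⟩ := outside_reach (A := mix H F (S \ D)) (S := S) hFf
        (fun p j h hj => tree_back h hj) (fun a ha h => mem_mix.2 (Or.inr ⟨ha, by
          intro h'; exact h (Finset.mem_sdiff.1 h').1⟩)) hi
    exact ⟨r, by rw [hroots]; exact h1, h3⟩
  have hmid : ∀ i, i ∈ S \ D →
      ∃ s ∈ rootSet (mix H F (S \ D)),
        Relation.ReflTransGen (arcRel (mix H F (S \ D))) i s := by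
    intro i hi
    obtain ⟨r, hr, hir⟩ := reach_of_forest hHf i
    obtain ⟨j, h1, h2, h3, h4⟩ := exit_lemma H (mix H F (S \ D)) (S \ D)
      (fun a ha h => mem_mix.2 (Or.inl ⟨ha, h⟩)) hir
    have hj : j ∉ S \ D := by
      rcases h3 with rfl | h3
      · intro h; exact hno j hr (Finset.mem_sdiff.1 h).1
      · exact h3
    rcases h4 with rfl | ⟨p, hp, hpj⟩
    · exact absurd hi hj
    · rw [Finset.mem_sdiff] at hp
      have hjD := hD p j hp.1 hp.2 hpj
      have hjS : j ∉ S := fun h => hj (Finset.mem_sdiff.2 ⟨h, hjD⟩)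
      obtain ⟨s, hs, hjs⟩ := hout j hjS
      exact ⟨s, hs, h1.trans hjs⟩
  refine ⟨?_, forest_of_reach (mix_func hHf.1 hFf.1) ?_, ?_⟩
  · intro a ha
    rcases mem_mix.1 ha with h | h
    · exact hHE h.1
    · exact hFE h.1
  · intro i
    obtain ⟨r, hr, hir⟩ := reach_of_forest hFf i
    obtain ⟨j, h1, h2, h3, -⟩ := exit_lemma F (mix H F (S \ D)) (S \ D)ᶜ
      (fun a ha h => mem_mix.2 (Or.inr ⟨ha, Finset.mem_compl.1 h⟩)) hir
    rcases h3 with rfl | h3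
    · exact ⟨j, by rw [hroots]; exact hr, h1⟩
    · obtain ⟨s, hs, hjs⟩ := hmid j (by simpa using h3)
      exact ⟨s, hs, h1.trans hjs⟩
  · rw [hroots, hFk]

lemma minForest_le {v : α → α → ℝ} {E F A : Finset (α × α)} {k : ℕ}
    (hF : IsMinForest v E k F) (hA : A ∈ FSet E k) : aweight v F ≤ aweight v A := by
  have h : (aweight v F : EReal) ≤ (aweight v A : EReal) := by
    rw [hF.2]
    exact sInf_le ⟨A, hA, rfl⟩
  exact_mod_cast h

lemma exists_tree_no_root {E F H : Finset (α × α)} {k : ℕ} (hk : 1 ≤ k) (hF : F ∈ FSet E k)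
    (hH : H ∈ FSet E (k - 1)) :
    ∃ l ∈ rootSet F, ∀ i ∈ rootSet H, i ∉ treeVerts F l := by
  choose f hf1 hf2 using fun i => reach_of_forest hF.2.1 i
  have hcard : ((rootSet H).image f).card < (rootSet F).card := by
    refine lt_of_le_of_lt Finset.card_image_le ?_
    rw [hH.2.2, hF.2.2]; omega
  obtain ⟨l, hl, hl'⟩ := Finset.exists_mem_notMem_of_card_lt_card hcard
  refine ⟨l, hl, fun i hi hil => hl' (Finset.mem_image.2 ⟨i, hi, ?_⟩)⟩
  have huniq : ∀ i, Relation.ReflTransGen (arcRel F) i l → f i = l := by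
    intro i hi
    have h1 : Relator.RightUnique (arcRel F) := fun a b c h h' => hF.2.1.1 _ _ _ h h'
    rcases Relation.ReflTransGen.total_of_right_unique h1 (hf2 i) hi with h | h
    · exact root_of_reach (hf1 i) h
    · exact (root_of_reach hl h).symm
  exact huniq i (mem_treeVerts.1 hil)

lemma key_lower {v : α → α → ℝ} {E F H : Finset (α × α)} {k : ℕ} (hk : 1 ≤ k)
    (hF : IsMinForest v E k F) (hH : H ∈ FSet E (k - 1)) :
    ∃ l ∈ rootSet F, ∃ q ∈ treeVerts F l, ∃ T, IsCTreeOn E T (treeVerts F l) q ∧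
      aweight v T + aweightOn v F (treeVerts F l)ᶜ ≤ aweight v H := by
  obtain ⟨l, hl, hno⟩ := exists_tree_no_root hk hF.1 hH
  refine ⟨l, hl, ?_⟩
  have hs1 := minForest_le hF (swap_one hk hF.1 hH hl hno)
  have htw : ∀ D, l ∈ D → _ := fun D hlD hD =>
    minForest_le hF (swap_two hF.1 hH hno D hlD hD)
  obtain ⟨hFE, hFf, hFk⟩ := hF.1
  obtain ⟨hHE, hHf, hHk⟩ := hH
  have hfwd : ∀ p j, (p, j) ∈ F → p ∈ treeVerts F l → j ∈ treeVerts F l :=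
    fun p j h hp => tree_fwd hFf.1 hl h hp
  have hreach : ∀ i ∈ treeVerts F l, Relation.ReflTransGen (arcRel F) i l :=
    fun i hi => mem_treeVerts.1 hi
  have hreach' : ∀ i, Relation.ReflTransGen (arcRel F) i l → i ∈ treeVerts F l :=
    fun i hi => mem_treeVerts.2 hi
  have hlS := tree_self F l
  set S := treeVerts F l with hS
  obtain ⟨r0, hr0, hlr0⟩ := reach_of_forest hHf l
  obtain ⟨q, t, hqS, htS, hqt, hlq⟩ := exit_step H S hlr0 hlS (hno r0 hr0)
  set D : Finset α := S.filter
    (fun x => Relation.ReflTransGen (arcRel (restrictArcs H S)) x q) with hDdef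
  have hmemD : ∀ x, x ∈ D ↔ x ∈ S ∧ Relation.ReflTransGen (arcRel (restrictArcs H S)) x q := by
    intro x; rw [hDdef, Finset.mem_filter]
  have hDS : D ⊆ S := Finset.filter_subset _ _
  clear_value D
  have hlD : l ∈ D := (hmemD l).2 ⟨hlS, hlq⟩
  have hqD : q ∈ D := (hmemD q).2 ⟨hqS, .refl⟩
  have hres : ∀ i j, arcRel (restrictArcs H S) i j ↔ (i, j) ∈ H ∧ i ∈ S ∧ j ∈ S := by
    intro i j; simp [arcRel, restrictArcs]
  have hs2 := htw D hlD (by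
    intro p j hp hpD hpj hj
    rw [hmemD] at hj
    exact hpD ((hmemD p).2 ⟨hp, .head ((hres _ _).2 ⟨hpj, hp, hj.1⟩) hj.2⟩))
  -- next step inside D
  have hDnext : ∀ x ∈ D, x ≠ q → ∃ j, (x, j) ∈ H ∧ j ∈ D := by
    intro x hx hxq
    rw [hmemD] at hx
    rcases Relation.ReflTransGen.cases_head hx.2 with h | ⟨c, hc, hcq⟩
    · exact absurd h hxq
    · rw [hres] at hc
      exact ⟨c, hc.1, (hmemD c).2 ⟨hc.2.2, hcq⟩⟩
  set T' := (mix H F D).filter (fun a => a.1 ∈ S ∧ a.1 ≠ q) with hT'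
  have hmemT : ∀ i j, (i, j) ∈ T' ↔
      (((i, j) ∈ H ∧ i ∈ D) ∨ ((i, j) ∈ F ∧ i ∉ D)) ∧ i ∈ S ∧ i ≠ q := by
    intro i j
    rw [hT', Finset.mem_filter, mem_mix]
  have hreachD : ∀ x ∈ D, Relation.ReflTransGen (arcRel T') x q := by
    intro x hx
    have hxq := ((hmemD x).1 hx).2
    clear hx
    induction hxq using Relation.ReflTransGen.head_induction_on with
    | refl => exact .refl
    | head hab hbr ih =>
      rename_i a b
      by_cases haq : a = q
      · rw [haq]
      · refine .head ?_ ih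
        have h := (hres _ _).1 hab
        exact (hmemT a b).2 ⟨Or.inl ⟨h.1, (hmemD a).2 ⟨h.2.1, .head hab hbr⟩⟩, h.2.1, haq⟩
  have htree : IsTreeOn E T' S q := by
    refine ⟨hqS, ?_, ?_, ?_, ?_, ?_⟩
    · rintro ⟨i, j⟩ ha
      rcases ((hmemT i j).1 ha).1 with h | h
      · exact hHE h.1
      · exact hFE h.1
    · rintro ⟨i, j⟩ ha
      obtain ⟨h, hiS, hiq⟩ := (hmemT i j).1 ha
      refine ⟨hiS, ?_⟩
      rcases h with h | h
      · obtain ⟨c, hc, hcD⟩ := hDnext i h.2 hiq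
        have : j = c := hHf.1 _ _ _ h.1 hc
        rw [this]; exact hDS hcD
      · exact hfwd _ _ h.1 hiS
    · intro i hi hiq
      by_cases hiD : i ∈ D
      · obtain ⟨c, hc, hcD⟩ := hDnext i hiD hiq
        refine ⟨c, (hmemT _ _).2 ⟨Or.inl ⟨hc, hiD⟩, hi, hiq⟩, ?_⟩
        intro j hj
        rcases ((hmemT i j).1 hj).1 with h | h
        · exact hHf.1 _ _ _ h.1 hc
        · exact absurd hiD h.2
      · rcases Relation.ReflTransGen.cases_head (hreach i hi) with h | ⟨c, hc, hcq⟩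
        · subst h; exact absurd hlD hiD
        · refine ⟨c, (hmemT _ _).2 ⟨Or.inr ⟨hc, hiD⟩, hi, hiq⟩, ?_⟩
          intro j hj
          rcases ((hmemT i j).1 hj).1 with h | h
          · exact absurd h.2 hiD
          · exact hFf.1 _ _ _ h.1 hc
    · intro j hj
      exact ((hmemT q j).1 hj).2.2 rfl
    · intro i hi
      obtain ⟨j, h1, h2, h3, -⟩ := exit_lemma F T' (S \ D)
        (by
          rintro ⟨a, b⟩ ha h
          rw [Finset.mem_sdiff] at h
          refine (hmemT a b).2 ⟨Or.inr ⟨ha, h.2⟩, h.1, ?_⟩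
          rintro rfl
          exact h.2 hqD) (hreach i hi)
      have hjD : j ∈ D := by
        rcases h3 with rfl | h3
        · exact hlD
        · by_contra hjD
          exact h3 (Finset.mem_sdiff.2 ⟨hreach' j h2, hjD⟩)
      exact h1.trans (hreachD j hjD)
  refine ⟨q, hqS, insert (q, t) T', ⟨t, htS, T', htree, hHE hqt, rfl⟩, ?_⟩
  have hTeq : insert (q, t) T' = (mix H F D).filter (fun a => a.1 ∈ S) := by
    ext ⟨i, j⟩
    rw [Finset.mem_insert, hmemT, Finset.mem_filter, mem_mix, Prod.mk.injEq]
    constructor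
    · rintro (⟨rfl, rfl⟩ | h)
      · exact ⟨Or.inl ⟨hqt, hqD⟩, hqS⟩
      · exact ⟨h.1, h.2.1⟩
    · rintro ⟨h1, h2⟩
      by_cases hiq : i = q
      · left
        refine ⟨hiq, ?_⟩
        subst hiq
        rcases h1 with h | h
        · exact hHf.1 _ _ _ h.1 hqt
        · exact absurd hqD h.2
      · exact Or.inr ⟨h1, h2, hiq⟩
  have hw : aweight v (insert (q, t) T') = aweightOn v (mix H F D) S := by
    rw [hTeq]; rfl
  have hmixS : aweightOn v (mix H F D) S = aweightOn v H D + aweightOn v F (S \ D) := by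
    rw [aweightOn_sdiff v _ hDS]
    unfold aweightOn
    congr 1
    · apply Finset.sum_congr _ (fun _ _ => rfl)
      ext a
      simp only [Finset.mem_filter, mem_mix]
      tauto
    · apply Finset.sum_congr _ (fun _ _ => rfl)
      ext a
      simp only [Finset.mem_filter, mem_mix, Finset.mem_sdiff]
      tauto
  rw [hw, hmixS]
  rw [aweight_mix, aweight_split v F S] at hs1
  rw [aweight_mix, aweight_split v F (S \ D)] at hs2
  rw [aweight_split v H S, aweightOn_sdiff v H hDS]
  linarith

lemma lamBul_eq {v : α → α → ℝ} {E F : Finset (α × α)} {k : ℕ}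
    (hF : IsMinForest v E k F) {l : α} (hl : l ∈ rootSet F) :
    lamBul v E (treeVerts F l) = (aweightOn v F (treeVerts F l) : ℝ) := by
  obtain ⟨hFE, hFf, hFk⟩ := hF.1
  apply le_antisymm
  · refine sInf_le ⟨F.filter (fun a => a.1 ∈ treeVerts F l), ⟨l, tree_self F l, ?_⟩, rfl⟩
    refine ⟨tree_self F l, (Finset.filter_subset _ _).trans hFE, ?_, ?_, ?_, ?_⟩
    · rintro ⟨i, j⟩ ha
      rw [Finset.mem_filter] at ha
      exact ⟨ha.2, tree_fwd hFf.1 hl ha.1 ha.2⟩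
    · intro i hi hil
      rcases Relation.ReflTransGen.cases_head (mem_treeVerts.1 hi) with h | ⟨c, hc, -⟩
      · exact absurd h hil
      · refine ⟨c, Finset.mem_filter.2 ⟨hc, hi⟩, ?_⟩
        intro j hj
        exact hFf.1 _ _ _ (Finset.mem_filter.1 hj).1 hc
    · intro j hj
      exact mem_rootSet.1 hl j (Finset.mem_filter.1 hj).1
    · intro i hi
      obtain ⟨j, h1, h2, h3, -⟩ := exit_lemma F (F.filter (fun a => a.1 ∈ treeVerts F l))
        (treeVerts F l) (fun a ha h => Finset.mem_filter.2 ⟨ha, h⟩) (mem_treeVerts.1 hi)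
      rcases h3 with rfl | h3
      · exact h1
      · exact absurd (mem_treeVerts.2 h2) h3
  · apply le_sInf
    rintro _ ⟨T, ⟨q, hq, hT⟩, rfl⟩
    have h := minForest_le hF (replace_tree hF.1 hl hT)
    rw [aweight_mix, aweight_split v F (treeVerts F l),
      aweightOn_of_tails v (fun a ha => (hT.2.2.1 a ha).1)] at h
    have h' : aweightOn v F (treeVerts F l) ≤ aweight v T := by linarith
    exact EReal.coe_le_coe_iff.2 h'

lemma desc_weight {v : α → α → ℝ} {E F G : Finset (α × α)} {y : α} (hFf : IsEForest F)
    (hGf : IsEForest G) (hGd : IsDescendant E F G y) :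
    aweightOn v G (treeVerts F y)ᶜ = aweightOn v F (treeVerts F y)ᶜ := by
  obtain ⟨hy, hroot, hres, -⟩ := hGd
  unfold aweightOn
  apply Finset.sum_congr _ (fun _ _ => rfl)
  ext ⟨i, j⟩
  simp only [Finset.mem_filter, Finset.mem_compl]
  have key : i ∉ treeVerts F y → ∃ q ∈ rootSet G, i ∈ treeVerts F q := by
    intro hi
    obtain ⟨r, hr, hir⟩ := reach_of_forest hFf i
    refine ⟨r, ?_, mem_treeVerts.2 hir⟩
    rw [hroot, Finset.mem_sdiff, Finset.mem_singleton]
    refine ⟨hr, ?_⟩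
    rintro rfl
    exact hi (mem_treeVerts.2 hir)
  have key2 : i ∉ treeVerts F y → ∀ c, (i, c) ∈ F → (i, c) ∈ G := by
    intro hi c hc
    obtain ⟨q, hq, hiq⟩ := key hi
    have h : (i, c) ∈ treeArcs F q := Finset.mem_filter.2 ⟨hc, hiq⟩
    rw [← hres q hq] at h
    exact (Finset.mem_filter.1 h).1
  constructor
  · rintro ⟨h, hi⟩
    refine ⟨?_, hi⟩
    obtain ⟨q, hq, hiq⟩ := key hi
    rcases Relation.ReflTransGen.cases_head (mem_treeVerts.1 hiq) with h' | ⟨c, hc, -⟩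
    · subst h'
      exact absurd h (mem_rootSet.1 hq j)
    · rw [hGf.1 _ _ _ h (key2 hi c hc)]
      exact hc
  · rintro ⟨h, hi⟩
    exact ⟨key2 hi j h, hi⟩

lemma desc_circ {v : α → α → ℝ} {E F G : Finset (α × α)} {y : α} (hGE : G ⊆ E)
    (hGf : IsEForest G) (hGd : IsDescendant E F G y) :
    lamCirc v E (treeVerts F y) ≤ (aweightOn v G (treeVerts F y) : ℝ) := by
  obtain ⟨hy, hroot, hres, a, ha, hT⟩ := hGd
  have haG : a ∉ rootSet G := by
    rw [hroot, Finset.mem_sdiff, Finset.mem_singleton]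
    rintro ⟨h1, h2⟩
    exact h2 ((root_in_tree h1).1 ha)
  rw [mem_rootSet] at haG
  push Not at haG
  obtain ⟨b, hab⟩ := haG
  have hb : b ∉ treeVerts F y := by
    intro hb
    exact hT.2.2.2.2.1 b (Finset.mem_filter.2 ⟨hab, ha, hb⟩)
  refine sInf_le ⟨G.filter (fun a => a.1 ∈ treeVerts F y), ⟨a, ha, b, hb, _, hT, hGE hab, ?_⟩, rfl⟩
  ext ⟨i, j⟩
  simp only [restrictArcs, Finset.mem_filter, Finset.mem_insert, Prod.mk.injEq]
  constructor
  · rintro ⟨h1, h2⟩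
    by_cases hia : i = a
    · subst hia
      exact Or.inl ⟨rfl, hGf.1 _ _ _ h1 hab⟩
    · obtain ⟨c, hc, -⟩ := hT.2.2.2.1 i h2 hia
      have hc' := Finset.mem_filter.1 hc
      have : j = c := hGf.1 _ _ _ h1 hc'.1
      subst this
      exact Or.inr ⟨h1, h2, hc'.2.2⟩
  · rintro (⟨rfl, rfl⟩ | h)
    · exact ⟨hab, ha⟩
    · exact ⟨h.1, h.2.1⟩

end helpers

/-- Theorem 2.  Let `F ∈ 𝓕̃^k`, `y ∈ K_F`, and let `G ∈ 𝓡^F_y` be a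
descendant of `F` (so `G ∈ 𝓕^{k-1}`).  Then `G ∈ 𝓕̃^{k-1}` iff
`Υ^G_{V(T^F_y)} = λ^∘_{V(T^F_y)}` and
`λ^∘_{V(T^F_y)} - λ^•_{V(T^F_y)} = min_{l ∈ K_F} (λ^∘_{V(T^F_l)} - λ^•_{V(T^F_l)})`. -/
theorem statement3 (v : α → α → ℝ) (E : Finset (α × α)) (hE : ∀ i, (i, i) ∉ E)
    (k : ℕ) (hk : 1 ≤ k) (F : Finset (α × α)) (hF : IsMinForest v E k F)
    (y : α) (hy : y ∈ rootSet F)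
    (G : Finset (α × α)) (hGk : G ∈ FSet E (k - 1)) (hGd : IsDescendant E F G y) :
    IsMinForest v E (k - 1) G ↔
      (((aweightOn v G (treeVerts F y) : ℝ) : EReal) = lamCirc v E (treeVerts F y) ∧
        lamCirc v E (treeVerts F y) - lamBul v E (treeVerts F y) =
          ⨅ l ∈ rootSet F, (lamCirc v E (treeVerts F l) - lamBul v E (treeVerts F l))) := by
  have hFf := hF.1.2.1
  have hGw : aweight v G = aweightOn v G (treeVerts F y) + aweightOn v F (treeVerts F y)ᶜ := by
    rw [aweight_split v G (treeVerts F y), desc_weight hFf hGk.2.1 hGd]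
  have hFw := fun l => aweight_split v F (treeVerts F l)
  constructor
  · intro hG
    have hup : ∀ l ∈ rootSet F, ∀ q ∈ treeVerts F l, ∀ T, IsCTreeOn E T (treeVerts F l) q →
        aweightOn v G (treeVerts F y) - aweightOn v F (treeVerts F y)
          + aweightOn v F (treeVerts F l) ≤ aweight v T := by
      intro l hl q hq T hT
      obtain ⟨h1, h2⟩ := replace_ctree hF.1 hl hT
      have h := minForest_le hG h1
      rw [aweight_mix, aweightOn_of_tails v h2, hGw] at h
      have e1 := hFw y
      have e2 := hFw l
      linarith
    have hupE : ∀ l ∈ rootSet F,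
        ((aweightOn v G (treeVerts F y) - aweightOn v F (treeVerts F y)
          + aweightOn v F (treeVerts F l) : ℝ) : EReal) ≤ lamCirc v E (treeVerts F l) := by
      intro l hl
      apply le_sInf
      rintro _ ⟨T, ⟨q, hq, hT⟩, rfl⟩
      exact EReal.coe_le_coe_iff.2 (hup l hl q hq T hT)
    have h1 : ((aweightOn v G (treeVerts F y) : ℝ) : EReal) = lamCirc v E (treeVerts F y) := by
      apply le_antisymm
      · have := hupE y hy
        rwa [sub_add_cancel] at this
      · exact desc_circ hGk.1 hGk.2.1 hGd
    refine ⟨h1, le_antisymm ?_ (iInf₂_le y hy)⟩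
    refine le_iInf₂ fun l hl => ?_
    rw [← h1, lamBul_eq hF hy, lamBul_eq hF hl, ← EReal.coe_sub]
    have h := EReal.sub_le_sub (hupE l hl)
      (le_refl ((aweightOn v F (treeVerts F l) : ℝ) : EReal))
    rwa [← EReal.coe_sub, add_sub_cancel_right] at h
  · rintro ⟨h1, h2⟩
    refine ⟨hGk, le_antisymm ?_ (sInf_le ⟨G, hGk, rfl⟩)⟩
    apply le_sInf
    rintro _ ⟨H, hH, rfl⟩
    obtain ⟨l, hl, q, hq, T, hT, hle⟩ := key_lower hk hF hH
    have h3 : lamCirc v E (treeVerts F y) - lamBul v E (treeVerts F y) ≤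
        lamCirc v E (treeVerts F l) - lamBul v E (treeVerts F l) := by
      rw [h2]; exact iInf₂_le l hl
    have h4 : lamCirc v E (treeVerts F l) ≤ (aweight v T : ℝ) :=
      sInf_le ⟨T, ⟨q, hq, hT⟩, rfl⟩
    rw [← h1, lamBul_eq hF hy, lamBul_eq hF hl] at h3
    have h5 := h3.trans (EReal.sub_le_sub h4 le_rfl)
    rw [← EReal.coe_sub, ← EReal.coe_sub, EReal.coe_le_coe_iff] at h5
    apply EReal.coe_le_coe_iff.2
    have e1 := hFw y
    have e2 := hFw l
    linarith

end BarrierForests
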